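/- arXiv:1507.08714 — 2 statements merged into one kernel-verified Lean document; each statement's English description precedes it below -/
import Mathlib

section
/- Let 2 ≤ p < ∞, let Ω ⊂ ℝⁿ (n ≥ 2) be a bounded domain, and let f : Ω×ℝ → ℝ be continuous with f(x,t) < 0 for all (x,t) ∈ Ω×ℝ. If u is upper semicontinuous on cl(Ω) and is a viscosity subsolution of Δ_p u + f(x,u) = 0 in Ω (i.e. Δ_p u + f(x,u) ≥ 0 in the viscosity sense), then sup_Ω u ≤ sup_{∂Ω} u. Dually, if f > 0 everywhere and u is lower semicontinuous on cl(Ω) with Δ_p u + f(x,u) ≤ 0 in the viscosity sense, then inf_Ω u ≥ inf_{∂Ω} u. -/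
open Set Filter
open scoped Classical

/-- The p-Laplacian of a C² test function, in the form used in viscosity solution theory:
`Δ_p φ = |Dφ|^{p-2} tr(D²φ) + (p-2)|Dφ|^{p-4} ⟨D²φ Dφ, Dφ⟩`, set to `0` when `Dφ = 0` and
`p ≠ 2`, and to `tr(D²φ)` when `p = 2`. -/
noncomputable def pLap (n : ℕ) (p : ℝ) (φ : EuclideanSpace ℝ (Fin n) → ℝ)
    (x : EuclideanSpace ℝ (Fin n)) : ℝ :=
  if gradient φ x = 0 then
    if p = 2 then
      ∑ i : Fin n, iteratedFDeriv ℝ 2 φ x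
        ![EuclideanSpace.single i (1 : ℝ), EuclideanSpace.single i (1 : ℝ)]
    else 0
  else
    ‖gradient φ x‖ ^ (p - 2) *
        ∑ i : Fin n, iteratedFDeriv ℝ 2 φ x
          ![EuclideanSpace.single i (1 : ℝ), EuclideanSpace.single i (1 : ℝ)] +
      (p - 2) * ‖gradient φ x‖ ^ (p - 4) *
        iteratedFDeriv ℝ 2 φ x ![gradient φ x, gradient φ x]

/-- The infinity-Laplacian `Δ_∞ φ = ⟨D²φ Dφ, Dφ⟩` of a C² test function. -/
noncomputable def infLap (n : ℕ) (φ : EuclideanSpace ℝ (Fin n) → ℝ)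
    (x : EuclideanSpace ℝ (Fin n)) : ℝ :=
  iteratedFDeriv ℝ 2 φ x ![gradient φ x, gradient φ x]

/-- Parabolic test functions: C² in the space variable and C¹ in the time variable. -/
def ParaTestFn (n : ℕ) (ψ : EuclideanSpace ℝ (Fin n) × ℝ → ℝ) : Prop :=
  (∀ t : ℝ, ContDiff ℝ 2 fun x => ψ (x, t)) ∧ ∀ x, ContDiff ℝ 1 fun t => ψ (x, t)

/-- The p-Laplacian in the space variable of a parabolic test function. -/
noncomputable def pSpaceLap (n : ℕ) (p : ℝ) (ψ : EuclideanSpace ℝ (Fin n) × ℝ → ℝ)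
    (q : EuclideanSpace ℝ (Fin n) × ℝ) : ℝ :=
  pLap n p (fun x => ψ (x, q.2)) q.1

/-- The time derivative `ψ_t` of a parabolic test function. -/
noncomputable def timeDeriv (n : ℕ) (ψ : EuclideanSpace ℝ (Fin n) × ℝ → ℝ)
    (q : EuclideanSpace ℝ (Fin n) × ℝ) : ℝ :=
  deriv (fun t => ψ (q.1, t)) q.2

/-- Viscosity subsolution of Trudinger's equation `Γ_p u = Δ_p u − (p−1)u^{p−2}u_t = 0` on `U`. -/
def TrudSub (n : ℕ) (p : ℝ) (U : Set (EuclideanSpace ℝ (Fin n) × ℝ))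
    (u : EuclideanSpace ℝ (Fin n) × ℝ → ℝ) : Prop :=
  ∀ ψ, ParaTestFn n ψ → ∀ q ∈ U, IsLocalMaxOn (fun z => u z - ψ z) U q →
    0 ≤ pSpaceLap n p ψ q - (p - 1) * u q ^ (p - 2) * timeDeriv n ψ q

/-- Viscosity supersolution of Trudinger's equation `Γ_p u = 0` on `U`. -/
def TrudSuper (n : ℕ) (p : ℝ) (U : Set (EuclideanSpace ℝ (Fin n) × ℝ))
    (u : EuclideanSpace ℝ (Fin n) × ℝ → ℝ) : Prop :=
  ∀ ψ, ParaTestFn n ψ → ∀ q ∈ U, IsLocalMinOn (fun z => u z - ψ z) U q →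
    pSpaceLap n p ψ q - (p - 1) * u q ^ (p - 2) * timeDeriv n ψ q ≤ 0

/-- Viscosity subsolution of `Δ_p u − (p−1)|u|^{p−2}u_t = 0` on `U`. -/
def TrudAbsSub (n : ℕ) (p : ℝ) (U : Set (EuclideanSpace ℝ (Fin n) × ℝ))
    (u : EuclideanSpace ℝ (Fin n) × ℝ → ℝ) : Prop :=
  ∀ ψ, ParaTestFn n ψ → ∀ q ∈ U, IsLocalMaxOn (fun z => u z - ψ z) U q →
    0 ≤ pSpaceLap n p ψ q - (p - 1) * |u q| ^ (p - 2) * timeDeriv n ψ q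

/-- Viscosity subsolution of `G_p w = Δ_p w + (p−1)|Dw|^p − (p−1)w_t = 0` on `U`. -/
def GpSub (n : ℕ) (p : ℝ) (U : Set (EuclideanSpace ℝ (Fin n) × ℝ))
    (w : EuclideanSpace ℝ (Fin n) × ℝ → ℝ) : Prop :=
  ∀ ψ, ParaTestFn n ψ → ∀ q ∈ U, IsLocalMaxOn (fun z => w z - ψ z) U q →
    0 ≤ pSpaceLap n p ψ q + (p - 1) * ‖gradient (fun x => ψ (x, q.2)) q.1‖ ^ p -
        (p - 1) * timeDeriv n ψ q

/-- Viscosity supersolution of `G_p w = 0` on `U`. -/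
def GpSuper (n : ℕ) (p : ℝ) (U : Set (EuclideanSpace ℝ (Fin n) × ℝ))
    (w : EuclideanSpace ℝ (Fin n) × ℝ → ℝ) : Prop :=
  ∀ ψ, ParaTestFn n ψ → ∀ q ∈ U, IsLocalMinOn (fun z => w z - ψ z) U q →
    pSpaceLap n p ψ q + (p - 1) * ‖gradient (fun x => ψ (x, q.2)) q.1‖ ^ p -
        (p - 1) * timeDeriv n ψ q ≤ 0

/-- Viscosity subsolution of `Γ_∞ u = Δ_∞ u − 3u²u_t = 0` on `U`. -/
def GammaInfSub (n : ℕ) (U : Set (EuclideanSpace ℝ (Fin n) × ℝ))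
    (u : EuclideanSpace ℝ (Fin n) × ℝ → ℝ) : Prop :=
  ∀ ψ, ParaTestFn n ψ → ∀ q ∈ U, IsLocalMaxOn (fun z => u z - ψ z) U q →
    0 ≤ infLap n (fun x => ψ (x, q.2)) q.1 - 3 * u q ^ 2 * timeDeriv n ψ q

/-- Viscosity supersolution of `Γ_∞ u = 0` on `U`. -/
def GammaInfSuper (n : ℕ) (U : Set (EuclideanSpace ℝ (Fin n) × ℝ))
    (u : EuclideanSpace ℝ (Fin n) × ℝ → ℝ) : Prop :=
  ∀ ψ, ParaTestFn n ψ → ∀ q ∈ U, IsLocalMinOn (fun z => u z - ψ z) U q →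
    infLap n (fun x => ψ (x, q.2)) q.1 - 3 * u q ^ 2 * timeDeriv n ψ q ≤ 0

/-- Viscosity subsolution of the elliptic equation `Δ_p u + f(x, u) = 0` on `Ω`. -/
def PLapFSub (n : ℕ) (p : ℝ) (f : EuclideanSpace ℝ (Fin n) → ℝ → ℝ)
    (Ω : Set (EuclideanSpace ℝ (Fin n))) (u : EuclideanSpace ℝ (Fin n) → ℝ) : Prop :=
  ∀ φ, ContDiff ℝ 2 φ → ∀ y ∈ Ω, IsLocalMaxOn (fun x => u x - φ x) Ω y →
    0 ≤ pLap n p φ y + f y (u y)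

/-- Viscosity supersolution of the elliptic equation `Δ_p u + f(x, u) = 0` on `Ω`. -/
def PLapFSuper (n : ℕ) (p : ℝ) (f : EuclideanSpace ℝ (Fin n) → ℝ → ℝ)
    (Ω : Set (EuclideanSpace ℝ (Fin n))) (u : EuclideanSpace ℝ (Fin n) → ℝ) : Prop :=
  ∀ φ, ContDiff ℝ 2 φ → ∀ y ∈ Ω, IsLocalMinOn (fun x => u x - φ x) Ω y →
    pLap n p φ y + f y (u y) ≤ 0

/-- The parabolic cylinder `Ω × I`. -/
def pcyl (n : ℕ) (Ω : Set (EuclideanSpace ℝ (Fin n))) (I : Set ℝ) :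
    Set (EuclideanSpace ℝ (Fin n) × ℝ) := Ω ×ˢ I

/-- The parabolic boundary `(cl(Ω) × {0}) ∪ (∂Ω × I)`. -/
def pbdry (n : ℕ) (Ω : Set (EuclideanSpace ℝ (Fin n))) (I : Set ℝ) :
    Set (EuclideanSpace ℝ (Fin n) × ℝ) := closure Ω ×ˢ {(0 : ℝ)} ∪ frontier Ω ×ˢ I

/-- The set of `λ ≥ 0` such that `Δ_p w + λ w^{p−1} = 0` in `Ω`, `w = δ` on `∂Ω`, has a positive
viscosity solution `w ∈ C(cl Ω)`; its supremum is the first eigenvalue `λ_Ω`. -/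
def pEigenSet (n : ℕ) (p δ : ℝ) (Ω : Set (EuclideanSpace ℝ (Fin n))) : Set ℝ :=
  {lam : ℝ | 0 ≤ lam ∧ ∃ w : EuclideanSpace ℝ (Fin n) → ℝ,
    ContinuousOn w (closure Ω) ∧ (∀ x ∈ closure Ω, 0 < w x) ∧
    PLapFSub n p (fun _ s => lam * s ^ (p - 1)) Ω w ∧
    PLapFSuper n p (fun _ s => lam * s ^ (p - 1)) Ω w ∧
    ∀ x ∈ frontier Ω, w x = δ}

/-- A positive viscosity solution of the boundary value problem `Γ_p u = 0` in `Ω × I`,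
`u = h` on the parabolic boundary. -/
def TrudBVPSol (n : ℕ) (p : ℝ) (Ω : Set (EuclideanSpace ℝ (Fin n))) (I : Set ℝ)
    (h u : EuclideanSpace ℝ (Fin n) × ℝ → ℝ) : Prop :=
  ContinuousOn u (pcyl n Ω I ∪ pbdry n Ω I) ∧
  (∀ q ∈ pcyl n Ω I ∪ pbdry n Ω I, 0 < u q) ∧
  TrudSub n p (pcyl n Ω I) u ∧ TrudSuper n p (pcyl n Ω I) u ∧
  ∀ q ∈ pbdry n Ω I, u q = h q

theorem pLap_const_zero (n : ℕ) (p : ℝ) (x : EuclideanSpace ℝ (Fin n)) :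
    pLap n p (fun _ => (0 : ℝ)) x = 0 := by
  have hg : gradient (fun _ : EuclideanSpace ℝ (Fin n) => (0 : ℝ)) x = 0 := by
    simp [gradient]
  have hD : iteratedFDeriv ℝ 2 (fun _ : EuclideanSpace ℝ (Fin n) => (0 : ℝ)) x = 0 :=
    congrFun iteratedFDeriv_fun_zero x
  simp [pLap, hg, hD]

theorem PLapFSub.notMem_of_isMaxOn {n : ℕ} {p : ℝ} {f : EuclideanSpace ℝ (Fin n) → ℝ → ℝ}
    {Ω : Set (EuclideanSpace ℝ (Fin n))} {u : EuclideanSpace ℝ (Fin n) → ℝ}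
    (hu : PLapFSub n p f Ω u) (hf : ∀ x ∈ Ω, ∀ s : ℝ, f x s < 0)
    {y : EuclideanSpace ℝ (Fin n)} (hy : IsMaxOn u Ω y) : y ∉ Ω := by
  intro hyΩ
  have h := hu (fun _ => 0) contDiff_const y hyΩ (by simpa using hy.localize)
  rw [pLap_const_zero] at h
  linarith [hf y hyΩ (u y)]

theorem PLapFSuper.notMem_of_isMinOn {n : ℕ} {p : ℝ} {f : EuclideanSpace ℝ (Fin n) → ℝ → ℝ}
    {Ω : Set (EuclideanSpace ℝ (Fin n))} {u : EuclideanSpace ℝ (Fin n) → ℝ}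
    (hu : PLapFSuper n p f Ω u) (hf : ∀ x ∈ Ω, ∀ s : ℝ, 0 < f x s)
    {y : EuclideanSpace ℝ (Fin n)} (hy : IsMinOn u Ω y) : y ∉ Ω := by
  intro hyΩ
  have h := hu (fun _ => 0) contDiff_const y hyΩ (by simpa using hy.localize)
  rw [pLap_const_zero] at h
  linarith [hf y hyΩ (u y)]

/-- Remark 6.1 (Maximum principle): for continuous `f` with `f < 0` (resp. `f > 0`) on
`Ω × ℝ`, a viscosity subsolution (resp. supersolution) of `Δ_p u + f(x,u) = 0` attains its
supremum (resp. infimum) on `∂Ω`. -/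
theorem stmt18 (n : ℕ) (hn : 2 ≤ n) (p : ℝ) (hp : 2 ≤ p)
    (Ω : Set (EuclideanSpace ℝ (Fin n))) (hΩo : IsOpen Ω) (hΩc : IsConnected Ω)
    (hΩb : Bornology.IsBounded Ω)
    (f : EuclideanSpace ℝ (Fin n) → ℝ → ℝ)
    (hf : ContinuousOn (Function.uncurry f) (Ω ×ˢ (Set.univ : Set ℝ))) :
    ((∀ x ∈ Ω, ∀ s : ℝ, f x s < 0) →
      ∀ u : EuclideanSpace ℝ (Fin n) → ℝ, UpperSemicontinuousOn u (closure Ω) →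
        PLapFSub n p f Ω u → sSup (u '' Ω) ≤ sSup (u '' frontier Ω)) ∧
    ((∀ x ∈ Ω, ∀ s : ℝ, 0 < f x s) →
      ∀ u : EuclideanSpace ℝ (Fin n) → ℝ, LowerSemicontinuousOn u (closure Ω) →
        PLapFSuper n p f Ω u → sInf (u '' frontier Ω) ≤ sInf (u '' Ω)) := by
  have hK : IsCompact (closure Ω) := hΩb.isCompact_closure
  have hne : (closure Ω).Nonempty := hΩc.nonempty.closure
  refine ⟨fun hneg u husc hu => ?_, fun hpos u hlsc hu => ?_⟩
  · obtain ⟨y, hy, hmax⟩ := husc.exists_isMaxOn hne hK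
    have hyF : y ∈ frontier Ω := by
      rw [hΩo.frontier_eq]
      exact ⟨hy, hu.notMem_of_isMaxOn hneg (hmax.on_subset subset_closure)⟩
    refine csSup_le (hΩc.nonempty.image u) ?_
    rintro _ ⟨x, hx, rfl⟩
    refine (hmax (subset_closure hx)).trans (le_csSup ⟨u y, ?_⟩ (mem_image_of_mem u hyF))
    rintro _ ⟨z, hz, rfl⟩
    exact hmax (frontier_subset_closure hz)
  · obtain ⟨y, hy, hmin⟩ := hlsc.exists_isMinOn hne hK
    have hyF : y ∈ frontier Ω := by
      rw [hΩo.frontier_eq]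
      exact ⟨hy, hu.notMem_of_isMinOn hpos (hmin.on_subset subset_closure)⟩
    refine le_csInf (hΩc.nonempty.image u) ?_
    rintro _ ⟨x, hx, rfl⟩
    refine (csInf_le ⟨u y, ?_⟩ (mem_image_of_mem u hyF)).trans (hmin (subset_closure hx))
    rintro _ ⟨z, hz, rfl⟩
    exact hmin (frontier_subset_closure hz)
end

section
/- Let 2 ≤ p < ∞, let Ω ⊂ ℝⁿ (n ≥ 2) be a bounded domain, and let 0 < λ < λ̄. Suppose u is upper semicontinuous on cl(Ω) and is a viscosity subsolution of Δ_p u + λ|u|^{p−2}u = 0 in Ω, and v is lower semicontinuous on cl(Ω), bounded, v > 0, and is a viscosity supersolution of Δ_p v + λ̄ v^{p−1} = 0 in Ω. Then either u ≤ 0 in Ω, or (u/v)(x) ≤ sup_{∂Ω}(u/v) for all x ∈ Ω. -/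
open Set Filter
open scoped Classical

open scoped RealInnerProductSpace Topology

section ConvexAnalysis

open MeasureTheory

variable {E : Type*} [NormedAddCommGroup E] [InnerProductSpace ℝ E]

/-- At a point where a function with subgradient selection `P` is touched from above by a
paraboloid, the selection is Lipschitz. -/
theorem subgradient_sub_le_of_paraboloid {f : E → ℝ} {P : E → E}
    (hP : ∀ z w, f z + ⟪P z, w - z⟫ ≤ f w) {x : E}
    (hx : ∀ z, f z ≤ f x + ⟪P x, z - x⟫ + ‖z - x‖ ^ 2) (z : E) :
    ‖P z - P x‖ ≤ 4 * ‖z - x‖ := by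
  have h1 := hP z (z + (1 / 4 : ℝ) • (P z - P x))
  have h2 := hx (z + (1 / 4 : ℝ) • (P z - P x))
  have h3 := hP z x
  have e1 : z + (1 / 4 : ℝ) • (P z - P x) - z = (1 / 4 : ℝ) • (P z - P x) := by abel
  have e2 : z + (1 / 4 : ℝ) • (P z - P x) - x = (z - x) + (1 / 4 : ℝ) • (P z - P x) := by abel
  rw [e1, inner_smul_right] at h1
  rw [e2, inner_add_right, inner_smul_right, norm_add_sq_real, norm_smul, inner_smul_right] at h2
  have h4 : ⟪P z, P z - P x⟫ - ⟪P x, P z - P x⟫ = ‖P z - P x‖ ^ 2 := by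
    rw [← inner_sub_left, real_inner_self_eq_norm_sq]
  have h5 : ⟪P z, x - z⟫ = - ⟪P z, z - x⟫ := by rw [← inner_neg_right, neg_sub]
  have h6 : ⟪P z - P x, z - x⟫ = ⟪P z, z - x⟫ - ⟪P x, z - x⟫ := inner_sub_left _ _ _
  have h7 : ⟪z - x, P z - P x⟫ = ⟪P z - P x, z - x⟫ := real_inner_comm _ _
  have h8 := abs_le.1 (abs_real_inner_le_norm (P z - P x) (z - x))
  have h9 : ‖(1 / 4 : ℝ)‖ = 1 / 4 := by norm_num
  rw [h9, h7] at h2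
  rw [h5] at h3
  have h10 : 0 ≤ ‖P z - P x‖ := norm_nonneg _
  have h11 : 0 ≤ ‖z - x‖ := norm_nonneg _
  have hx' := hP x z
  by_contra! hcon
  nlinarith

/-- At a maximum point of a sum of two convex functions minus a paraboloid and a linear function,
the first function is touched from above by a paraboloid. -/
theorem paraboloid_of_isMax_add {f₁ f₂ : E → ℝ} {P₁ P₂ : E → E}
    (hP₁ : ∀ z w, f₁ z + ⟪P₁ z, w - z⟫ ≤ f₁ w) (hP₂ : ∀ z w, f₂ z + ⟪P₂ z, w - z⟫ ≤ f₂ w)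
    {x q : E} (hx : ∀ z, f₁ z + f₂ z - ‖z‖ ^ 2 - ⟪q, z⟫ ≤ f₁ x + f₂ x - ‖x‖ ^ 2 - ⟪q, x⟫) :
    P₁ x + P₂ x - (2 : ℝ) • x = q ∧
      ∀ z, f₁ z ≤ f₁ x + ⟪P₁ x, z - x⟫ + ‖z - x‖ ^ 2 := by
  have hexp : ∀ d : E, ‖x + d‖ ^ 2 = ‖x‖ ^ 2 + ⟪(2 : ℝ) • x, d⟫ + ‖d‖ ^ 2 := fun d => by
    rw [norm_add_sq_real, inner_smul_left]; simp
  have key : ∀ d : E, ⟪P₁ x + P₂ x - (2 : ℝ) • x - q, d⟫ ≤ ‖d‖ ^ 2 := by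
    intro d
    have h1 := hP₁ x (x + d)
    have h2 := hP₂ x (x + d)
    have h3 := hx (x + d)
    rw [hexp, inner_add_right] at h3
    rw [add_sub_cancel_left] at h1 h2
    rw [inner_sub_left, inner_sub_left, inner_add_left]
    linarith
  have hq : P₁ x + P₂ x - (2 : ℝ) • x = q := by
    have h := key ((1 / 2 : ℝ) • (P₁ x + P₂ x - (2 : ℝ) • x - q))
    rw [inner_smul_right, real_inner_self_eq_norm_sq, norm_smul] at h
    have h9 : ‖(1 / 2 : ℝ)‖ = 1 / 2 := by norm_num
    rw [h9] at h
    have h0 : ‖P₁ x + P₂ x - (2 : ℝ) • x - q‖ ^ 2 = 0 :=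
      le_antisymm (by nlinarith) (sq_nonneg _)
    exact sub_eq_zero.1 (norm_eq_zero.1 (pow_eq_zero_iff two_ne_zero |>.1 h0))
  refine ⟨hq, fun z => ?_⟩
  have h2 := hP₂ x z
  have h3 := hx z
  have h4 := hexp (z - x)
  rw [add_sub_cancel] at h4
  have h5 : ⟪q, z⟫ - ⟪q, x⟫ = ⟪P₁ x, z - x⟫ + ⟪P₂ x, z - x⟫ - ⟪(2 : ℝ) • x, z - x⟫ := by
    rw [← inner_sub_right, ← hq, inner_sub_left, inner_add_left]
  linarith

theorem abs_sub_le_of_abs_sub_le_sq {k : ℝ → ℝ} {b c : ℝ}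
    (h : ∀ s t, 0 ≤ s → s ≤ t → t ≤ 1 → |k t - k s| ≤ c * (t - s) ^ 2 + b * (t - s)) :
    |k 1 - k 0| ≤ b := by
  have key : ∀ N : ℕ, |k 1 - k 0| ≤ c / ((N : ℝ) + 1) + b := by
    intro N
    have hN : (0 : ℝ) < (N : ℝ) + 1 := by positivity
    have step : ∀ i : ℕ, i ≤ N + 1 →
        |k (i / ((N : ℝ) + 1)) - k 0| ≤ i * (c / ((N : ℝ) + 1) ^ 2 + b / ((N : ℝ) + 1)) := by
      intro i
      induction i with
      | zero => simp
      | succ i ih =>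
        intro hi
        have h1 := ih (by omega)
        have hi' : ((i : ℝ) + 1) ≤ (N : ℝ) + 1 := by exact_mod_cast hi
        have h2 := h (i / ((N : ℝ) + 1)) ((i + 1) / ((N : ℝ) + 1)) (by positivity)
          (by gcongr; linarith) (by rw [div_le_one hN]; exact hi')
        have h3 : ((i : ℝ) + 1) / ((N : ℝ) + 1) - i / ((N : ℝ) + 1) = 1 / ((N : ℝ) + 1) := by
          field_simp; ring
        rw [h3] at h2
        have h4 := abs_sub_le (k ((i + 1) / ((N : ℝ) + 1))) (k (i / ((N : ℝ) + 1))) (k 0)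
        push_cast
        have h5 : c * (1 / ((N : ℝ) + 1)) ^ 2 + b * (1 / ((N : ℝ) + 1)) =
          c / ((N : ℝ) + 1) ^ 2 + b / ((N : ℝ) + 1) := by field_simp
        rw [h5] at h2
        linarith
    have := step (N + 1) le_rfl
    push_cast at this
    rw [div_self hN.ne'] at this
    refine this.trans (le_of_eq ?_)
    field_simp
  have hlim : Filter.Tendsto (fun N : ℕ => c / ((N : ℝ) + 1) + b) Filter.atTop (𝓝 (0 + b)) :=
    by
    have := (tendsto_one_div_add_atTop_nhds_zero_nat (𝕜 := ℝ)).const_mul c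
    simp only [mul_one_div, mul_zero] at this
    exact this.add_const b
  rw [zero_add] at hlim
  exact ge_of_tendsto' hlim key

/-- A function with a subgradient selection differentiable at `x` has a second order Taylor
expansion at `x`. -/
theorem taylor_two_of_hasFDerivAt_subgradient {f : E → ℝ} {P : E → E}
    (hP : ∀ z w, f z + ⟪P z, w - z⟫ ≤ f w) {x : E} {A : E →L[ℝ] E} (hA : HasFDerivAt P A x)
    {τ : ℝ} (hτ : 0 < τ) :
    ∀ᶠ d in 𝓝 (0 : E),
      |f (x + d) - f x - ⟪P x, d⟫ - 1 / 2 * ⟪A d, d⟫| ≤ τ * ‖d‖ ^ 2 := by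
  have h0 := (hasFDerivAt_iff_isLittleO_nhds_zero.1 hA).bound hτ
  obtain ⟨r, hr, hball⟩ := Metric.eventually_nhds_iff.1 h0
  refine Metric.eventually_nhds_iff.2 ⟨r, hr, fun d hd => ?_⟩
  have hPt : ∀ t : ℝ, 0 ≤ t → t ≤ 1 →
      |⟪P (x + t • d), d⟫ - ⟪P x, d⟫ - t * ⟪A d, d⟫| ≤ τ * ‖d‖ ^ 2 := by
    intro t ht0 ht1
    have hn : ‖t • d‖ ≤ ‖d‖ := by
      rw [norm_smul, Real.norm_of_nonneg ht0]
      nlinarith [norm_nonneg d]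
    have hb := hball (y := t • d) (by
      rw [dist_zero_right] at hd ⊢
      exact hn.trans_lt hd)
    have e : ⟪P (x + t • d), d⟫ - ⟪P x, d⟫ - t * ⟪A d, d⟫ =
        ⟪P (x + t • d) - P x - A (t • d), d⟫ := by
      rw [inner_sub_left, inner_sub_left, map_smul, inner_smul_left]; simp
    rw [e]
    refine (abs_real_inner_le_norm _ _).trans ?_
    have := norm_nonneg d
    calc _ ≤ (τ * ‖d‖) * ‖d‖ := by gcongr; exact hb.trans (by gcongr)
      _ = _ := by ring
  have := abs_sub_le_of_abs_sub_le_sq (b := τ * ‖d‖ ^ 2) (c := |⟪A d, d⟫| / 2)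
    (k := fun t => f (x + t • d) - t * ⟪P x, d⟫ - t ^ 2 / 2 * ⟪A d, d⟫) (by
      intro s t hs hst ht
      have h1 := hP (x + t • d) (x + s • d)
      have h2 := hP (x + s • d) (x + t • d)
      have e1 : x + s • d - (x + t • d) = (s - t) • d := by rw [sub_smul]; abel
      have e2 : x + t • d - (x + s • d) = (t - s) • d := by rw [sub_smul]; abel
      rw [e1, inner_smul_right] at h1
      rw [e2, inner_smul_right] at h2
      have h3 := abs_le.1 (hPt t (hs.trans hst) ht)
      have h4 := abs_le.1 (hPt s hs (hst.trans ht))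
      have hts : 0 ≤ t - s := sub_nonneg.2 hst
      have h5 := mul_le_mul_of_nonneg_left h3.2 hts
      have h6 := mul_le_mul_of_nonneg_left h4.1 hts
      have h7 := mul_le_mul_of_nonneg_left (le_abs_self ⟪A d, d⟫) (sq_nonneg (t - s))
      have h8 := mul_le_mul_of_nonneg_left (neg_abs_le ⟪A d, d⟫) (sq_nonneg (t - s))
      rw [abs_le]
      constructor <;> nlinarith)
  simp only [one_smul, zero_smul, add_zero] at this
  convert this using 2
  ring

variable [FiniteDimensional ℝ E]

theorem exists_isMax_add_sub_sq {f₁ f₂ : E → ℝ} {P₁ P₂ : E → E} {R : ℝ}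
    (hP₁ : ∀ z w, f₁ z + ⟪P₁ z, w - z⟫ ≤ f₁ w) (hP₂ : ∀ z w, f₂ z + ⟪P₂ z, w - z⟫ ≤ f₂ w)
    (hR₁ : ∀ z, ‖P₁ z‖ ≤ R) (hR₂ : ∀ z, ‖P₂ z‖ ≤ R) (q : E) :
    ∃ x, ∀ z, f₁ z + f₂ z - ‖z‖ ^ 2 - ⟪q, z⟫ ≤ f₁ x + f₂ x - ‖x‖ ^ 2 - ⟪q, x⟫ := by
  have hcont : ∀ {f : E → ℝ} {P : E → E}, (∀ z w, f z + ⟪P z, w - z⟫ ≤ f w) →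
      (∀ z, ‖P z‖ ≤ R) → (∀ z w, f z ≤ f w + R * ‖z - w‖) := by
    intro f P hP hR z w
    have h1 := hP z w
    have h2 := abs_le.1 (abs_real_inner_le_norm (P z) (w - z))
    have h3 := mul_le_mul_of_nonneg_right (hR z) (norm_nonneg (w - z))
    rw [norm_sub_rev z w]
    linarith
  have hR : 0 ≤ R := (norm_nonneg _).trans (hR₁ 0)
  have hc₁ : Continuous f₁ :=
    (LipschitzWith.of_le_add_mul ⟨R, hR⟩ fun z w => by
      rw [dist_eq_norm]; exact hcont hP₁ hR₁ z w).continuous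
  have hc₂ : Continuous f₂ :=
    (LipschitzWith.of_le_add_mul ⟨R, hR⟩ fun z w => by
      rw [dist_eq_norm]; exact hcont hP₂ hR₂ z w).continuous
  have hρ : 0 ≤ 2 * R + ‖q‖ := by positivity
  obtain ⟨x, hxm, hx⟩ := (isCompact_closedBall (0 : E) (2 * R + ‖q‖)).exists_isMaxOn
    ⟨0, by simpa using hρ⟩
    (f := fun z => f₁ z + f₂ z - ‖z‖ ^ 2 - ⟪q, z⟫) (by fun_prop)
  refine ⟨x, fun z => ?_⟩
  by_cases hz : z ∈ Metric.closedBall (0 : E) (2 * R + ‖q‖)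
  · exact hx hz
  · rw [mem_closedBall_zero_iff, not_le] at hz
    have h0 := hx (show (0 : E) ∈ Metric.closedBall (0 : E) (2 * R + ‖q‖) by simpa using hρ)
    simp only [mem_ofPred_eq, norm_zero, inner_zero_right] at h0
    have h1 := hcont hP₁ hR₁ z 0
    have h2 := hcont hP₂ hR₂ z 0
    have h3 := abs_le.1 (abs_real_inner_le_norm q z)
    rw [sub_zero] at h1 h2
    nlinarith [norm_nonneg z]

variable [MeasurableSpace E] [BorelSpace E]

/-- A Jensen–Alexandrov type lemma: the sum of two convex functions minus a paraboloid has, after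
a small linear perturbation, a maximum point at which both subgradient selections are
differentiable. -/
theorem exists_isMax_hasFDerivAt_subgradient {f₁ f₂ : E → ℝ} {P₁ P₂ : E → E} {R : ℝ}
    (hP₁ : ∀ z w, f₁ z + ⟪P₁ z, w - z⟫ ≤ f₁ w) (hP₂ : ∀ z w, f₂ z + ⟪P₂ z, w - z⟫ ≤ f₂ w)
    (hR₁ : ∀ z, ‖P₁ z‖ ≤ R) (hR₂ : ∀ z, ‖P₂ z‖ ≤ R) {δ : ℝ} (hδ : 0 < δ) :
    ∃ (x q : E) (A₁ A₂ : E →L[ℝ] E), ‖q‖ < δ ∧ P₁ x + P₂ x - (2 : ℝ) • x = q ∧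
      (∀ z, f₁ z + f₂ z - ‖z‖ ^ 2 - ⟪q, z⟫ ≤ f₁ x + f₂ x - ‖x‖ ^ 2 - ⟪q, x⟫) ∧
      HasFDerivAt P₁ A₁ x ∧ HasFDerivAt P₂ A₂ x ∧ ‖A₁‖ ≤ 4 ∧ ‖A₂‖ ≤ 4 := by
  set M : E → E → Prop := fun q x =>
    ∀ z, f₁ z + f₂ z - ‖z‖ ^ 2 - ⟪q, z⟫ ≤ f₁ x + f₂ x - ‖x‖ ^ 2 - ⟪q, x⟫ with hM
  set K : Set E := {x | ∃ q, M q x} with hK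
  have hL₁ : ∀ x ∈ K, ∀ z, ‖P₁ z - P₁ x‖ ≤ 4 * ‖z - x‖ := by
    rintro x ⟨q, hq⟩
    exact subgradient_sub_le_of_paraboloid hP₁ (paraboloid_of_isMax_add hP₁ hP₂ hq).2
  have hL₂ : ∀ x ∈ K, ∀ z, ‖P₂ z - P₂ x‖ ≤ 4 * ‖z - x‖ := by
    rintro x ⟨q, hq⟩
    refine subgradient_sub_le_of_paraboloid hP₂
      (paraboloid_of_isMax_add hP₂ hP₁ (q := q) fun z => ?_).2
    have := hq z
    linarith
  have hLip : ∀ {P : E → E}, (∀ x ∈ K, ∀ z, ‖P z - P x‖ ≤ 4 * ‖z - x‖) →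
      LipschitzOnWith 4 P K := fun h =>
    LipschitzOnWith.of_dist_le_mul fun x _ y hy => by
      rw [dist_eq_norm, dist_eq_norm]; exact h y hy x
  obtain ⟨p₁, hp₁, he₁⟩ := (hLip hL₁).extend_finite_dimension
  obtain ⟨p₂, hp₂, he₂⟩ := (hLip hL₂).extend_finite_dimension
  let μ : Measure E := μH[Module.finrank ℝ E]
  have hbad : μ {x | ¬ (DifferentiableAt ℝ p₁ x ∧ DifferentiableAt ℝ p₂ x ∧
      DifferentiableAt ℝ (fun y => Metric.infDist y K) x)} = 0 := by
    have : ∀ᵐ x ∂μ, DifferentiableAt ℝ p₁ x ∧ DifferentiableAt ℝ p₂ x ∧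
        DifferentiableAt ℝ (fun y => Metric.infDist y K) x := by
      filter_upwards [hp₁.ae_differentiableAt (μ := μ), hp₂.ae_differentiableAt (μ := μ),
        (Metric.lipschitz_infDist_pt K).ae_differentiableAt (μ := μ)] with x h1 h2 h3
      exact ⟨h1, h2, h3⟩
    exact this
  set N : Set E := {x | ¬ (DifferentiableAt ℝ p₁ x ∧ DifferentiableAt ℝ p₂ x ∧
      DifferentiableAt ℝ (fun y => Metric.infDist y K) x)} with hN
  have hQ := (hp₁.add hp₂).sub ((2 : ℝ) • (ContinuousLinearMap.id ℝ E)).lipschitz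
  have himg : μ ((fun x => p₁ x + p₂ x - (2 : ℝ) • x) '' N) = 0 := by
    refine le_antisymm ((hQ.hausdorffMeasure_image_le (Nat.cast_nonneg _) N).trans ?_) zero_le
    change _ * μ N ≤ 0
    rw [hbad, mul_zero]
  have hpos : 0 < μ (Metric.ball (0 : E) δ) := Metric.measure_ball_pos μ 0 hδ
  obtain ⟨q, hqb, hqN⟩ : ∃ q ∈ Metric.ball (0 : E) δ,
      q ∉ (fun x => p₁ x + p₂ x - (2 : ℝ) • x) '' N := by
    by_contra! hcon
    exact absurd (measure_mono_null hcon himg) hpos.ne'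
  obtain ⟨x, hx⟩ := exists_isMax_add_sub_sq hP₁ hP₂ hR₁ hR₂ q
  have hxK : x ∈ K := ⟨q, hx⟩
  have hq := (paraboloid_of_isMax_add hP₁ hP₂ hx).1
  have hxN : x ∉ N := fun h => hqN ⟨x, h, by
    change p₁ x + p₂ x - (2 : ℝ) • x = q
    rw [← he₁ hxK, ← he₂ hxK]; exact hq⟩
  rw [hN, mem_ofPred_eq, not_not] at hxN
  obtain ⟨hd₁, hd₂, hd⟩ := hxN
  have hdist : (fun d => Metric.infDist (x + d) K) =o[𝓝 0] fun d => d := by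
    have hmin : IsLocalMin (fun y => Metric.infDist y K) x := by
      refine Filter.Eventually.of_forall fun y => ?_
      change Metric.infDist x K ≤ Metric.infDist y K
      rw [Metric.infDist_zero_of_mem hxK]
      exact Metric.infDist_nonneg
    have h := hasFDerivAt_iff_isLittleO_nhds_zero.1 hd.hasFDerivAt
    rw [hmin.fderiv_eq_zero] at h
    simpa [Metric.infDist_zero_of_mem hxK] using h
  have hder : ∀ {P p : E → E} {C : NNReal}, (∀ x ∈ K, ∀ z, ‖P z - P x‖ ≤ 4 * ‖z - x‖) →
      LipschitzWith C p → EqOn P p K → DifferentiableAt ℝ p x →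
      HasFDerivAt P (fderiv ℝ p x) x := by
    intro P p C hPL hpL hPp hdp
    have h := hasFDerivAt_iff_isLittleO_nhds_zero.1 hdp.hasFDerivAt
    rw [hasFDerivAt_iff_isLittleO_nhds_zero]
    have hdiff : (fun d => P (x + d) - p (x + d)) =o[𝓝 0] fun d => d := by
      refine Asymptotics.IsBigO.trans_isLittleO
        (Asymptotics.IsBigO.of_bound (4 + C) (Filter.Eventually.of_forall fun d => ?_)) hdist
      have hC : (0 : ℝ) < 4 + C := by positivity
      rw [Real.norm_of_nonneg Metric.infDist_nonneg, ← div_le_iff₀' hC,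
        Metric.le_infDist ⟨x, hxK⟩]
      intro k hk
      rw [div_le_iff₀' hC]
      have h1 := hPL k hk (x + d)
      have h2 := hpL.dist_le_mul k (x + d)
      rw [dist_eq_norm, dist_eq_norm, norm_sub_rev k] at h2
      rw [dist_eq_norm]
      calc ‖P (x + d) - p (x + d)‖ = ‖(P (x + d) - P k) + (p k - p (x + d))‖ := by
            rw [hPp hk]; congr 1; abel
        _ ≤ ‖P (x + d) - P k‖ + ‖p k - p (x + d)‖ := norm_add_le _ _
        _ ≤ _ := by linarith
    refine (hdiff.add h).congr_left fun d => ?_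
    rw [hPp hxK]; abel
  have hnorm : ∀ {P : E → E} {A : E →L[ℝ] E}, (∀ x ∈ K, ∀ z, ‖P z - P x‖ ≤ 4 * ‖z - x‖) →
      HasFDerivAt P A x → ‖A‖ ≤ 4 := fun hPL hA =>
    hA.le_of_lip' (by norm_num) (Filter.Eventually.of_forall fun z => hPL x hxK z)
  have hA₁ := hder hL₁ hp₁ he₁ hd₁
  have hA₂ := hder hL₂ hp₂ he₂ hd₂
  exact ⟨x, q, _, _, by simpa using hqb, hq, hx, hA₁, hA₂, hnorm hL₁ hA₁, hnorm hL₂ hA₂⟩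

end ConvexAnalysis

section PLaplaceOperator

variable {n : ℕ}

/-- The p-Laplacian as a function of the gradient `η` and the Hessian `A`. -/
noncomputable def pLapOp (p : ℝ) (η : EuclideanSpace ℝ (Fin n))
    (A : EuclideanSpace ℝ (Fin n) →L[ℝ] EuclideanSpace ℝ (Fin n)) : ℝ :=
  ‖η‖ ^ (p - 2) *
      ∑ i : Fin n, ⟪A (EuclideanSpace.single i (1 : ℝ)), EuclideanSpace.single i (1 : ℝ)⟫ +
    (p - 2) * ‖η‖ ^ (p - 4) * ⟪A η, η⟫

theorem pLap_eq_pLapOp {p : ℝ} (hp : 2 ≤ p) {φ : EuclideanSpace ℝ (Fin n) → ℝ}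
    {x η : EuclideanSpace ℝ (Fin n)}
    {A : EuclideanSpace ℝ (Fin n) →L[ℝ] EuclideanSpace ℝ (Fin n)}
    (hη : gradient φ x = η) (hA : ∀ v, iteratedFDeriv ℝ 2 φ x ![v, v] = ⟪A v, v⟫) :
    pLap n p φ x = pLapOp p η A := by
  unfold pLap pLapOp
  simp only [hη, hA]
  split_ifs with h0 h2
  · subst h2
    simp [h0]
  · have : p - 2 ≠ 0 := sub_ne_zero.2 h2
    simp [h0, Real.zero_rpow this]
  · rfl

theorem pLapOp_smul {p c : ℝ} (hc : 0 < c) (η : EuclideanSpace ℝ (Fin n))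
    (A : EuclideanSpace ℝ (Fin n) →L[ℝ] EuclideanSpace ℝ (Fin n)) :
    pLapOp p (c • η) (c • A) = c ^ (p - 1) * pLapOp p η A := by
  unfold pLapOp
  have h1 : c ^ (p - 1) = c ^ (p - 2) * c := by
    rw [← Real.rpow_add_one hc.ne']; congr 1; ring
  have h2 : c ^ (p - 1) = c ^ (p - 4) * (c * c * c) := by
    rw [← mul_assoc, ← mul_assoc, ← Real.rpow_add_one hc.ne', ← Real.rpow_add_one hc.ne',
      ← Real.rpow_add_one hc.ne']
    congr 1; ring
  have h3 : ∀ v w : EuclideanSpace ℝ (Fin n), ⟪(c • A) v, w⟫ = c * ⟪A v, w⟫ := fun v w => by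
    rw [smul_apply, real_inner_smul_left]
  simp only [h3, map_smul, real_inner_smul_left, real_inner_smul_right, norm_smul,
    Real.norm_of_nonneg hc.le, Real.mul_rpow hc.le (norm_nonneg η), ← Finset.mul_sum]
  rw [mul_add]
  nth_rewrite 1 [h1]
  rw [h2]
  ring

theorem pLapOp_mono {p : ℝ} (hp : 2 ≤ p) (η : EuclideanSpace ℝ (Fin n))
    {A B : EuclideanSpace ℝ (Fin n) →L[ℝ] EuclideanSpace ℝ (Fin n)}
    (h : ∀ d, ⟪A d, d⟫ ≤ ⟪B d, d⟫) : pLapOp p η A ≤ pLapOp p η B := by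
  unfold pLapOp
  have := sub_nonneg.2 hp
  gcongr
  · exact h _
  · exact h _

theorem continuous_pLapOp {p : ℝ} (hp : 2 ≤ p) :
    Continuous fun z : EuclideanSpace ℝ (Fin n) ×
      (EuclideanSpace ℝ (Fin n) →L[ℝ] EuclideanSpace ℝ (Fin n)) => pLapOp p z.1 z.2 := by
  unfold pLapOp
  refine Continuous.add ?_ ?_
  · refine Continuous.mul ?_ (by fun_prop)
    exact continuous_fst.norm.rpow_const fun _ => Or.inr (sub_nonneg.2 hp)
  · rcases hp.eq_or_lt with rfl | hp'
    · simpa using continuous_const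
    · rw [continuous_iff_continuousAt]
      rintro ⟨η, A⟩
      by_cases hη : η = 0
      · subst hη
        have hlim : Tendsto (fun z : EuclideanSpace ℝ (Fin n) ×
            (EuclideanSpace ℝ (Fin n) →L[ℝ] EuclideanSpace ℝ (Fin n)) =>
              (p - 2) * (‖z.1‖ ^ (p - 2) * ‖z.2‖)) (𝓝 (0, A)) (𝓝 0) := by
          have hc : Continuous (fun z : EuclideanSpace ℝ (Fin n) ×
            (EuclideanSpace ℝ (Fin n) →L[ℝ] EuclideanSpace ℝ (Fin n)) =>
              (p - 2) * (‖z.1‖ ^ (p - 2) * ‖z.2‖)) :=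
            continuous_const.mul ((continuous_fst.norm.rpow_const fun _ =>
              Or.inr (sub_nonneg.2 hp)).mul continuous_snd.norm)
          have := hc.tendsto (0, A)
          simpa [Real.zero_rpow (sub_pos.2 hp').ne'] using this
        unfold ContinuousAt
        simp only [inner_zero_right, mul_zero]
        refine squeeze_zero_norm (fun z => ?_) hlim
        by_cases hz : z.1 = 0
        · simp only [hz, inner_zero_right, mul_zero, norm_zero]
          have := sub_nonneg.2 hp
          positivity
        · have hz' : 0 < ‖z.1‖ := norm_pos_iff.2 hz
          rw [norm_mul, norm_mul, Real.norm_of_nonneg (sub_nonneg.2 hp),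
            Real.norm_of_nonneg (by positivity : 0 ≤ ‖z.1‖ ^ (p - 4)), mul_assoc]
          refine mul_le_mul_of_nonneg_left ?_ (sub_nonneg.2 hp)
          have h1 : ‖⟪z.2 z.1, z.1⟫‖ ≤ ‖z.2‖ * ‖z.1‖ * ‖z.1‖ :=
            (norm_inner_le_norm _ _).trans (by gcongr; exact z.2.le_opNorm _)
          have h2 : ‖z.1‖ ^ (p - 2) = ‖z.1‖ ^ (p - 4) * (‖z.1‖ * ‖z.1‖) := by
            rw [← mul_assoc, ← Real.rpow_add_one hz'.ne', ← Real.rpow_add_one hz'.ne']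
            congr 1; ring
          rw [h2]
          calc _ ≤ ‖z.1‖ ^ (p - 4) * (‖z.2‖ * ‖z.1‖ * ‖z.1‖) := by gcongr
            _ = _ := by ring
      · refine ContinuousAt.mul (ContinuousAt.mul continuousAt_const ?_) (by fun_prop)
        exact continuousAt_fst.norm.rpow_const (Or.inl (norm_ne_zero_iff.2 hη))

/-- Approximate monotonicity of the p-Laplace operator, uniform on bounded sets. -/
theorem exists_pLapOp_sub_lt {p : ℝ} (hp : 2 ≤ p) (R : ℝ) {κ : ℝ} (hκ : 0 < κ) :
    ∃ δ > 0, ∀ (η η' : EuclideanSpace ℝ (Fin n))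
      (A B : EuclideanSpace ℝ (Fin n) →L[ℝ] EuclideanSpace ℝ (Fin n)),
      ‖η‖ ≤ R → ‖η'‖ ≤ R → ‖B‖ ≤ R → ‖η - η'‖ ≤ δ →
      (∀ d, ⟪A d, d⟫ ≤ ⟪B d, d⟫ + δ * ‖d‖ ^ 2) → pLapOp p η A - pLapOp p η' B < κ := by
  have huc := (isCompact_closedBall (0 : EuclideanSpace ℝ (Fin n) ×
      (EuclideanSpace ℝ (Fin n) →L[ℝ] EuclideanSpace ℝ (Fin n))) (R + 1)
      ).uniformContinuousOn_of_continuous (continuous_pLapOp hp).continuousOn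
  rw [Metric.uniformContinuousOn_iff] at huc
  obtain ⟨r, hr, h⟩ := huc κ hκ
  refine ⟨min (r / 2) 1, by positivity, fun η η' A B hη hη' hB hηη hAB => ?_⟩
  set δ := min (r / 2) 1 with hδ
  have hδ0 : 0 < δ := by positivity
  have hδr : δ < r := (min_le_left _ _).trans_lt (by linarith)
  have hδ1 : δ ≤ 1 := min_le_right _ _
  have hid : ‖δ • ContinuousLinearMap.id ℝ (EuclideanSpace ℝ (Fin n))‖ ≤ δ := by
    rw [norm_smul, Real.norm_of_nonneg hδ0.le]
    exact mul_le_of_le_one_right hδ0.le ContinuousLinearMap.norm_id_le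
  have h1 : pLapOp p η A ≤ pLapOp p η (B + δ • ContinuousLinearMap.id ℝ _) := by
    refine pLapOp_mono hp η fun d => (hAB d).trans (le_of_eq ?_)
    simp [inner_add_left, real_inner_smul_left]
  have h2 := h (η, B + δ • ContinuousLinearMap.id ℝ _) (by
      rw [mem_closedBall_zero_iff, Prod.norm_def, max_le_iff]
      exact ⟨by simp only; linarith, (norm_add_le _ _).trans (by linarith)⟩) (η', B) (by
      rw [mem_closedBall_zero_iff, Prod.norm_def, max_le_iff]
      exact ⟨by simp only; linarith, by simp only; linarith⟩) (by
      rw [Prod.dist_eq, max_lt_iff, dist_eq_norm, dist_eq_norm]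
      refine ⟨hηη.trans_lt hδr, ?_⟩
      simp only [add_sub_cancel_left]
      exact hid.trans_lt hδr)
  rw [Real.dist_eq] at h2
  have := (abs_lt.1 h2).2
  simp only at this
  linarith

/-- The quadratic polynomial with prescribed value, gradient and Hessian at `y`. -/
noncomputable def quadPoly {E : Type*} [NormedAddCommGroup E] [InnerProductSpace ℝ E]
    (c : ℝ) (y η : E) (A : E →L[ℝ] E) (z : E) : ℝ :=
  c + ⟪η, z - y⟫ + 1 / 2 * ⟪A (z - y), z - y⟫

theorem contDiff_quadPoly {E : Type*} [NormedAddCommGroup E] [InnerProductSpace ℝ E]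
    (c : ℝ) (y η : E) (A : E →L[ℝ] E) : ContDiff ℝ 2 (quadPoly c y η A) := by
  unfold quadPoly
  exact (contDiff_const.add (contDiff_const.inner ℝ (by fun_prop))).add
    (contDiff_const.mul (ContDiff.inner ℝ (by fun_prop) (by fun_prop)))

/-- The Hessian of `quadPoly` as a bilinear form. -/
noncomputable def quadHess {E : Type*} [NormedAddCommGroup E] [InnerProductSpace ℝ E]
    (A : E →L[ℝ] E) : E →L[ℝ] E →L[ℝ] ℝ :=
  let B : E →L[ℝ] E →L[ℝ] ℝ := innerSL ℝ
  (1 / 2 : ℝ) • (B.comp A + (B.comp A).flip)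

theorem quadHess_apply {E : Type*} [NormedAddCommGroup E] [InnerProductSpace ℝ E]
    (A : E →L[ℝ] E) (v w : E) : quadHess A v w = 1 / 2 * (⟪A v, w⟫ + ⟪A w, v⟫) := rfl

theorem fderiv_quadPoly {E : Type*} [NormedAddCommGroup E] [InnerProductSpace ℝ E]
    (c : ℝ) (y η : E) (A : E →L[ℝ] E) :
    fderiv ℝ (quadPoly c y η A) = fun z => innerSL ℝ η +
      quadHess A (z - y) := by
  funext z
  have h1 : HasFDerivAt (fun z : E => z - y) (ContinuousLinearMap.id ℝ E) z :=
    (hasFDerivAt_id z).sub_const y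
  have h2 : HasFDerivAt (fun z : E => ⟪η, z - y⟫) ((innerSL ℝ η).comp (.id ℝ E)) z :=
    (innerSL ℝ η).hasFDerivAt.comp z h1
  have h3 := (A.hasFDerivAt.comp z h1).inner ℝ h1
  have h4 := (h2.const_add c).add (h3.const_mul (1 / 2))
  refine HasFDerivAt.fderiv (h4.congr_fderiv ?_)
  ext w
  simp [quadHess_apply, real_inner_comm, inner_sub_left, inner_sub_right]
  ring

theorem pLap_quadPoly {p : ℝ} (hp : 2 ≤ p) (c : ℝ) (y η : EuclideanSpace ℝ (Fin n))
    (A : EuclideanSpace ℝ (Fin n) →L[ℝ] EuclideanSpace ℝ (Fin n)) :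
    pLap n p (quadPoly c y η A) y = pLapOp p η A := by
  refine pLap_eq_pLapOp hp ?_ fun v => ?_
  · refine HasGradientAt.gradient ?_
    rw [hasGradientAt_iff_hasFDerivAt]
    have h := ((contDiff_quadPoly c y η A).differentiable (by norm_num) y).hasFDerivAt
    rw [fderiv_quadPoly] at h
    refine h.congr_fderiv ?_
    ext w
    simp
  · rw [iteratedFDeriv_two_apply, fderiv_quadPoly]
    have h : HasFDerivAt (fun z => innerSL ℝ η + quadHess A (z - y)) (quadHess A) y :=
      ((quadHess A).hasFDerivAt.comp y ((hasFDerivAt_id y).sub_const y)).const_add _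
    rw [h.fderiv]
    simp [quadHess_apply]
    ring

end PLaplaceOperator

section Comparison

variable {E : Type*} [NormedAddCommGroup E] [InnerProductSpace ℝ E]

theorem quadPoly_smul (k c : ℝ) (y η : E) (A : E →L[ℝ] E) (z : E) :
    quadPoly (k * c) y (k • η) (k • A) z = k * quadPoly c y η A z := by
  simp only [quadPoly, smul_apply, real_inner_smul_left]
  ring

/-- A maximizing selection for the Legendre transform of an upper semicontinuous function on a
compact set. -/
theorem exists_selection_isMax_inner_add {C : Set E} (hC : IsCompact C) (hne : C.Nonempty)
    {g : E → ℝ} (hg : UpperSemicontinuousOn g C) :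
    ∃ P : E → E, (∀ z, P z ∈ C) ∧ ∀ z, ∀ y ∈ C,
      ⟪z, y⟫ + (g y - 1 / 2 * ‖y‖ ^ 2) ≤ ⟪z, P z⟫ + (g (P z) - 1 / 2 * ‖P z‖ ^ 2) := by
  have h : ∀ z : E, ∃ w ∈ C, ∀ y ∈ C,
      ⟪z, y⟫ + (g y - 1 / 2 * ‖y‖ ^ 2) ≤ ⟪z, w⟫ + (g w - 1 / 2 * ‖w‖ ^ 2) := by
    intro z
    have hc : ContinuousOn (fun y : E => ⟪z, y⟫ - 1 / 2 * ‖y‖ ^ 2) C := by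
      have : Continuous (fun y : E => ⟪z, y⟫) := continuous_const.inner continuous_id
      fun_prop
    obtain ⟨w, hw, hmax⟩ := (hg.add hc.upperSemicontinuousOn).exists_isMaxOn hne hC
    refine ⟨w, hw, fun y hy => ?_⟩
    have : g y + (⟪z, y⟫ - 1 / 2 * ‖y‖ ^ 2) ≤ g w + (⟪z, w⟫ - 1 / 2 * ‖w‖ ^ 2) := hmax hy
    linarith
  choose P hPC hP using h
  exact ⟨P, hPC, hP⟩

theorem legendre_subgradient {C : Set E} {g : E → ℝ} {P : E → E} (hPC : ∀ z, P z ∈ C)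
    (hP : ∀ z, ∀ y ∈ C, ⟪z, y⟫ + g y ≤ ⟪z, P z⟫ + g (P z)) (z w : E) :
    (⟪z, P z⟫ + g (P z)) + ⟪P z, w - z⟫ ≤ ⟪w, P w⟫ + g (P w) := by
  refine le_trans (le_of_eq ?_) (hP w (P z) (hPC z))
  rw [inner_sub_right, real_inner_comm (P z) w, real_inner_comm (P z) z]
  ring

/-- Twice differentiability of the sup-convolution of `g` at `x` yields a quadratic polynomial
touching `g` from above at the maximizer. -/
theorem eventually_le_quadPoly {C : Set E} {g : E → ℝ} {P : E → E} (hPC : ∀ z, P z ∈ C)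
    (hP : ∀ z, ∀ y ∈ C,
      ⟪z, y⟫ + (g y - 1 / 2 * ‖y‖ ^ 2) ≤ ⟪z, P z⟫ + (g (P z) - 1 / 2 * ‖P z‖ ^ 2))
    {x : E} {A : E →L[ℝ] E} (hA : HasFDerivAt P A x) {τ : ℝ} (hτ : 0 < τ) :
    ∀ᶠ y in 𝓝 (P x), y ∈ C →
      g y ≤ quadPoly (g (P x)) (P x) (P x - x)
        (A - (1 - 2 * τ) • ContinuousLinearMap.id ℝ E) y := by
  have ht := taylor_two_of_hasFDerivAt_subgradient
    (legendre_subgradient (g := fun y => g y - 1 / 2 * ‖y‖ ^ 2) hPC hP) hA hτ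
  have hlim : Tendsto (fun y => y - P x) (𝓝 (P x)) (𝓝 0) := by
    have : Continuous fun y => y - P x := by fun_prop
    simpa using this.tendsto (P x)
  filter_upwards [hlim.eventually ht] with y hy hyC
  have h1 := (abs_le.1 hy).2
  set d := y - P x with hd
  have hyd : y = P x + d := by rw [hd]; abel
  have h2 := hP (x + d) y hyC
  rw [hyd] at h2 ⊢
  simp only [quadPoly, add_sub_cancel_left, sub_apply, smul_apply,
    ContinuousLinearMap.id_apply, inner_sub_left, real_inner_smul_left,
    real_inner_self_eq_norm_sq]
  simp only [inner_add_left, inner_add_right, real_inner_self_eq_norm_sq, norm_add_sq_real] at h1 h2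
  have h3 := real_inner_comm d (P x)
  linarith

theorem inner_add_inner_le_of_isMax {f₁ f₂ : E → ℝ} {P₁ P₂ : E → E} {A₁ A₂ : E →L[ℝ] E}
    (hP₁ : ∀ z w, f₁ z + ⟪P₁ z, w - z⟫ ≤ f₁ w) (hP₂ : ∀ z w, f₂ z + ⟪P₂ z, w - z⟫ ≤ f₂ w)
    {x q : E} (hx : ∀ z, f₁ z + f₂ z - ‖z‖ ^ 2 - ⟪q, z⟫ ≤ f₁ x + f₂ x - ‖x‖ ^ 2 - ⟪q, x⟫)
    (hA₁ : HasFDerivAt P₁ A₁ x) (hA₂ : HasFDerivAt P₂ A₂ x) {τ : ℝ} (hτ : 0 < τ) (d : E) :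
    ⟪A₁ d, d⟫ + ⟪A₂ d, d⟫ ≤ (2 + 4 * τ) * ‖d‖ ^ 2 := by
  have hq := (paraboloid_of_isMax_add hP₁ hP₂ hx).1
  have h1 := taylor_two_of_hasFDerivAt_subgradient hP₁ hA₁ hτ
  have h2 := taylor_two_of_hasFDerivAt_subgradient hP₂ hA₂ hτ
  have hlim : Tendsto (fun t : ℝ => t • d) (𝓝[>] 0) (𝓝 0) := by
    have : Continuous fun t : ℝ => t • d := by fun_prop
    have := this.tendsto 0
    rw [zero_smul] at this
    exact this.mono_left nhdsWithin_le_nhds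
  obtain ⟨t, ⟨ht1, ht2⟩, ht⟩ :=
    ((hlim.eventually (h1.and h2)).and self_mem_nhdsWithin).exists
  have ht0 : 0 < t ^ 2 := pow_pos ht 2
  have h3 := (abs_le.1 ht1).1
  have h4 := (abs_le.1 ht2).1
  have h5 := hx (x + t • d)
  have h6 : ⟪q, t • d⟫ = ⟪P₁ x, t • d⟫ + ⟪P₂ x, t • d⟫ - 2 * ⟪x, t • d⟫ := by
    rw [← hq, inner_sub_left, inner_add_left, real_inner_smul_left]
  rw [norm_add_sq_real, inner_add_right, h6] at h5
  simp only [map_smul, real_inner_smul_left, real_inner_smul_right, norm_smul, mul_pow,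
    Real.norm_eq_abs, sq_abs] at h3 h4 h5
  refine le_of_mul_le_mul_left ?_ ht0
  linarith

/-- If `u ≤ V` with equality only in the open set `Ω`, then almost-contact pairs lie in `Ω` and
satisfy a strict inequality between the zero order terms. -/
theorem exists_forall_almost_contact {E : Type*} [NormedAddCommGroup E] {C Ω : Set E}
    (hC : IsCompact C) (hΩ : IsOpen Ω) {u V : E → ℝ} (hu : UpperSemicontinuousOn u C)
    (hV : LowerSemicontinuousOn V C)
    (hle : ∀ x ∈ C, u x ≤ V x) (heq : ∀ x ∈ C, u x = V x → x ∈ Ω) {p lam lam' m : ℝ}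
    (hp : 2 ≤ p) (hlam : 0 < lam) (hlam' : lam < lam') (hm : 0 < m) (hmV : ∀ x ∈ C, m ≤ V x) :
    ∃ ε > 0, ∀ y ∈ C, ∀ ξ ∈ C, -ε ≤ u y - V ξ → ‖y - ξ‖ ≤ ε → y ∈ Ω ∧ ξ ∈ Ω ∧
      lam * |u y| ^ (p - 2) * u y + (lam' - lam) / 2 * m ^ (p - 1) ≤ lam' * V ξ ^ (p - 1) := by
  by_contra! hcon
  have hpos : ∀ k : ℕ, (0 : ℝ) < 1 / ((k : ℝ) + 1) := fun k => by positivity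
  choose y hy ξ hξ huV hyξ hbad using fun k : ℕ => hcon _ (hpos k)
  obtain ⟨x, hx, φ, hφ, hyx⟩ := hC.tendsto_subseq hy
  have hε : Tendsto (fun k => 1 / ((φ k : ℝ) + 1)) atTop (𝓝 0) :=
    (tendsto_one_div_add_atTop_nhds_zero_nat (𝕜 := ℝ)).comp hφ.tendsto_atTop
  have hdiff : Tendsto (fun k => y (φ k) - ξ (φ k)) atTop (𝓝 0) :=
    squeeze_zero_norm (fun k => hyξ (φ k)) hε
  have hξx : Tendsto (fun k => ξ (φ k)) atTop (𝓝 x) := by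
    have := hyx.sub hdiff
    simpa using this
  have hyx' : Tendsto (fun k => y (φ k)) atTop (𝓝[C] x) :=
    tendsto_nhdsWithin_iff.2 ⟨hyx, Eventually.of_forall fun k => hy _⟩
  have hξx' : Tendsto (fun k => ξ (φ k)) atTop (𝓝[C] x) :=
    tendsto_nhdsWithin_iff.2 ⟨hξx, Eventually.of_forall fun k => hξ _⟩
  have hxe : u x = V x := by
    refine le_antisymm (hle x hx) (not_lt.1 fun hlt => ?_)
    obtain ⟨c, hc1, hc2⟩ := exists_between hlt
    obtain ⟨e, he1, he2⟩ := exists_between hc2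
    obtain ⟨k, ⟨hk1, hk2⟩, hk3⟩ := (((hyx'.eventually (hu x hx c hc1)).and
      (hξx'.eventually (hV x hx e he2))).and
      (hε.eventually (gt_mem_nhds (sub_pos.2 he1)))).exists
    have := huV (φ k)
    linarith
  have hxΩ := heq x hx hxe
  have hL : 0 < V x := hm.trans_le (hmV x hx)
  have hp1 : 0 ≤ p - 1 := by linarith
  have hcont : Continuous fun t : ℝ => lam' * (V x - t) ^ (p - 1) - lam * (V x + t) ^ (p - 1) :=
    (continuous_const.mul ((continuous_const.sub continuous_id).rpow_const
      fun _ => Or.inr hp1)).sub (continuous_const.mul ((continuous_const.add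
        continuous_id).rpow_const fun _ => Or.inr hp1))
  have hgap : (lam' - lam) / 2 * m ^ (p - 1) <
      lam' * (V x - 0) ^ (p - 1) - lam * (V x + 0) ^ (p - 1) := by
    rw [sub_zero, add_zero]
    have h1 : m ^ (p - 1) ≤ V x ^ (p - 1) := Real.rpow_le_rpow hm.le (hmV x hx) hp1
    have h2 : 0 < V x ^ (p - 1) := Real.rpow_pos_of_pos hL _
    nlinarith
  obtain ⟨t, ⟨htgap, htL⟩, ht⟩ := ((((hcont.tendsto 0).mono_left nhdsWithin_le_nhds).eventually
    (lt_mem_nhds hgap)).and ((tendsto_id.mono_left nhdsWithin_le_nhds).eventually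
      (gt_mem_nhds hL)) |>.and (self_mem_nhdsWithin (a := (0 : ℝ)) (s := Ioi 0))).exists
  simp only [id] at htL
  obtain ⟨k, ⟨hk1, hk2⟩, hk3, hk4⟩ := (((hyx.eventually (hΩ.mem_nhds hxΩ)).and
    (hξx.eventually (hΩ.mem_nhds hxΩ))).and
    ((hyx'.eventually (hu x hx (V x + t) (show u x < V x + t by linarith))).and
      (hξx'.eventually (hV x hx (V x - t) (show V x - t < V x by linarith))))).exists
  refine absurd (hbad (φ k) hk1 hk2) (not_lt.2 ?_)
  have h1 : |u (y (φ k))| ^ (p - 2) * u (y (φ k)) ≤ (V x + t) ^ (p - 1) := by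
    rcases le_or_gt (u (y (φ k))) 0 with h | h
    · exact (mul_nonpos_of_nonneg_of_nonpos (by positivity) h).trans (by positivity)
    · rw [abs_of_pos h, ← Real.rpow_add_one h.ne']
      have : p - 2 + 1 = p - 1 := by ring
      rw [this]
      exact Real.rpow_le_rpow h.le hk3.le hp1
  have h2 : (V x - t) ^ (p - 1) ≤ V (ξ (φ k)) ^ (p - 1) :=
    Real.rpow_le_rpow (by linarith) hk4.le hp1
  have h3 := mul_le_mul_of_nonneg_left h1 hlam.le
  have h4 := mul_le_mul_of_nonneg_left h2 (hlam.trans hlam').le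
  rw [mul_assoc]
  linarith

/-- A viscosity subsolution and a supersolution of equations with strictly ordered zero order
terms, tested with quadratic polynomials, cannot be in contact from below only inside `Ω`. -/
theorem no_interior_contact {n : ℕ} {C Ω : Set (EuclideanSpace ℝ (Fin n))} (hC : IsCompact C)
    (hΩ : IsOpen Ω) {u V : EuclideanSpace ℝ (Fin n) → ℝ} (hu : UpperSemicontinuousOn u C)
    (hV : LowerSemicontinuousOn V C) (hle : ∀ x ∈ C, u x ≤ V x)
    (heq : ∀ x ∈ C, u x = V x → x ∈ Ω) {p lam lam' m : ℝ}
    (hp : 2 ≤ p) (hlam : 0 < lam) (hlam' : lam < lam') (hm : 0 < m) (hmV : ∀ x ∈ C, m ≤ V x)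
    (hsub : ∀ y ∈ Ω, ∀ η A, (∀ᶠ z in 𝓝 y, z ∈ C → u z ≤ quadPoly (u y) y η A z) →
      0 ≤ pLapOp p η A + lam * |u y| ^ (p - 2) * u y)
    (hsuper : ∀ y ∈ Ω, ∀ η A, (∀ᶠ z in 𝓝 y, z ∈ C → quadPoly (V y) y η A z ≤ V z) →
      pLapOp p η A + lam' * V y ^ (p - 1) ≤ 0)
    {x₀ : EuclideanSpace ℝ (Fin n)} (hx₀ : x₀ ∈ C) : u x₀ ≠ V x₀ := by
  intro hcontact
  obtain ⟨ε₀, hε₀, hnear⟩ := exists_forall_almost_contact hC hΩ hu hV hle heq hp hlam hlam' hm hmV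
  obtain ⟨R, hR⟩ := hC.isBounded.exists_norm_le
  have hR0 : 0 ≤ R := (norm_nonneg _).trans (hR x₀ hx₀)
  obtain ⟨U, hU0, hU⟩ : ∃ U : ℝ, 0 ≤ U ∧ ∀ x ∈ C, u x ≤ U := by
    obtain ⟨w, -, hw⟩ := hu.exists_isMaxOn ⟨x₀, hx₀⟩ hC
    exact ⟨|u w|, abs_nonneg _, fun x hx => (hw hx).trans (le_abs_self _)⟩
  set ε : ℝ := ε₀ ^ 2 / (4 * (U + ε₀)) with hε
  have hε0 : 0 < ε := by positivity
  have hεeq : 4 * ε * (U + ε₀) = ε₀ ^ 2 := by rw [hε]; field_simp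
  set κ : ℝ := (lam' - lam) / 2 * m ^ (p - 1) with hκ
  have hκ0 : 0 < κ := mul_pos (by linarith) (Real.rpow_pos_of_pos hm _)
  obtain ⟨δ₀, hδ₀, hop⟩ := exists_pLapOp_sub_lt (n := n) hp (ε⁻¹ * (2 * R + 6)) hκ0
  set δ : ℝ := min 1 (min (ε * δ₀) (ε * ε₀ / (2 * R + 1))) with hδ
  have hδ0 : 0 < δ := by positivity
  have hδ1 : δ ≤ 1 := min_le_left _ _
  have hδ2 : δ ≤ ε * δ₀ := (min_le_right _ _).trans (min_le_left _ _)
  have hδ3 : δ * (2 * R + 1) ≤ ε * ε₀ := by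
    rw [← le_div_iff₀ (by positivity)]
    exact (min_le_right _ _).trans (min_le_right _ _)
  set τ : ℝ := min (1 / 2) (ε * δ₀ / 8) with hτ
  have hτ0 : 0 < τ := by positivity
  have hτ1 : τ ≤ 1 / 2 := min_le_left _ _
  have hτ2 : 8 * τ ≤ ε * δ₀ := by
    have : τ ≤ ε * δ₀ / 8 := min_le_right _ _
    linarith
  have hg₁ : UpperSemicontinuousOn (fun y => ε * u y) C :=
    (continuous_const.mul continuous_id : Continuous fun t : ℝ => ε * t).comp_upperSemicontinuousOn
      hu fun a b hab => mul_le_mul_of_nonneg_left hab hε0.le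
  have hg₂ : UpperSemicontinuousOn (fun y => -ε * V y) C :=
    (continuous_const.mul continuous_id :
      Continuous fun t : ℝ => -ε * t).comp_lowerSemicontinuousOn_antitone hV
      fun a b hab => mul_le_mul_of_nonpos_left hab (by linarith)
  obtain ⟨P₁, hPC₁, hP₁⟩ := exists_selection_isMax_inner_add hC ⟨x₀, hx₀⟩ hg₁
  obtain ⟨P₂, hPC₂, hP₂⟩ := exists_selection_isMax_inner_add hC ⟨x₀, hx₀⟩ hg₂
  have hs₁ := legendre_subgradient (g := fun y => ε * u y - 1 / 2 * ‖y‖ ^ 2) hPC₁ hP₁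
  have hs₂ := legendre_subgradient (g := fun y => -ε * V y - 1 / 2 * ‖y‖ ^ 2) hPC₂ hP₂
  obtain ⟨x, q, A₁, A₂, hqδ, hq, hmax, hA₁, hA₂, hn₁, hn₂⟩ :=
    exists_isMax_hasFDerivAt_subgradient hs₁ hs₂ (fun z => hR _ (hPC₁ z))
      (fun z => hR _ (hPC₂ z)) hδ0
  have hy := hPC₁ x
  have hξ := hPC₂ x
  have hxR : ‖x‖ ≤ R + 1 / 2 := by
    have h1 : (2 : ℝ) • x = P₁ x + P₂ x - q := by rw [← hq]; abel
    have h2 : ‖(2 : ℝ) • x‖ ≤ 2 * R + 1 := by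
      rw [h1]
      have := norm_sub_le (P₁ x + P₂ x) q
      have := norm_add_le (P₁ x) (P₂ x)
      have := hR _ hy
      have := hR _ hξ
      linarith
    rw [norm_smul, Real.norm_two] at h2
    linarith
  have hkey : 1 / 2 * ‖x - P₁ x‖ ^ 2 + 1 / 2 * ‖x - P₂ x‖ ^ 2 ≤
      ε * (u (P₁ x) - V (P₂ x)) + ε * ε₀ := by
    have h1 := hmax x₀
    have h2 := hP₁ x₀ x₀ hx₀
    have h3 := hP₂ x₀ x₀ hx₀
    have h4 : ε * u x₀ = ε * V x₀ := by rw [hcontact]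
    have h5 : ⟪q, x₀⟫ - ⟪q, x⟫ ≤ ε * ε₀ := by
      rw [← inner_sub_right]
      refine (real_inner_le_norm _ _).trans (le_trans ?_ hδ3)
      have := norm_sub_le x₀ x
      have := hR x₀ hx₀
      gcongr
      linarith
    rw [real_inner_self_eq_norm_sq] at h2 h3
    rw [norm_sub_sq_real, norm_sub_sq_real]
    linarith
  obtain ⟨hyΩ, hξΩ, hgap⟩ := hnear _ hy _ hξ (by
      have : 0 ≤ ε * (u (P₁ x) - V (P₂ x) + ε₀) := by
        have := sq_nonneg ‖x - P₁ x‖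
        have := sq_nonneg ‖x - P₂ x‖
        linarith
      have := nonneg_of_mul_nonneg_right this hε0
      linarith) (by
      have h1 : u (P₁ x) - V (P₂ x) ≤ U := by
        have := hU _ hy
        have := hmV _ hξ
        linarith
      have h2 := mul_le_mul_of_nonneg_left h1 hε0.le
      have h3 : ‖P₁ x - P₂ x‖ ≤ ‖x - P₁ x‖ + ‖x - P₂ x‖ := by
        rw [norm_sub_rev x (P₁ x)]
        exact norm_sub_le_norm_sub_add_norm_sub _ _ _
      refine abs_le_of_sq_le_sq' ?_ hε₀.le |>.2
      have h4 : ‖P₁ x - P₂ x‖ ^ 2 ≤ (‖x - P₁ x‖ + ‖x - P₂ x‖) ^ 2 := by gcongr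
      nlinarith [sq_nonneg (‖x - P₁ x‖ - ‖x - P₂ x‖)])
  have ht₁ := eventually_le_quadPoly hPC₁ hP₁ hA₁ hτ0
  have ht₂ := eventually_le_quadPoly hPC₂ hP₂ hA₂ hτ0
  have hε1 : 0 < ε⁻¹ := inv_pos.2 hε0
  have hcancel : ∀ a : ℝ, ε⁻¹ * (ε * a) = a := fun a => inv_mul_cancel_left₀ hε0.ne' a
  have hcancel' : ∀ a : ℝ, -ε⁻¹ * (-ε * a) = a := fun a => by
    rw [neg_mul, neg_mul, mul_neg, neg_neg, hcancel]
  set B₁ := A₁ - (1 - 2 * τ) • ContinuousLinearMap.id ℝ (EuclideanSpace ℝ (Fin n)) with hB₁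
  set B₂ := A₂ - (1 - 2 * τ) • ContinuousLinearMap.id ℝ (EuclideanSpace ℝ (Fin n)) with hB₂
  have hfin₁ := hsub _ hyΩ (ε⁻¹ • (P₁ x - x)) (ε⁻¹ • B₁) (by
    filter_upwards [ht₁] with z hz hzC
    have h := mul_le_mul_of_nonneg_left (hz hzC) hε1.le
    rw [← quadPoly_smul, hcancel, hcancel] at h
    exact h)
  have hfin₂ := hsuper _ hξΩ ((-ε⁻¹) • (P₂ x - x)) ((-ε⁻¹) • B₂) (by
    filter_upwards [ht₂] with z hz hzC
    have h := mul_le_mul_of_nonpos_left (hz hzC) (neg_nonpos.2 hε1.le)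
    rw [← quadPoly_smul, hcancel', hcancel'] at h
    exact h)
  have hBn : ‖B₂‖ ≤ 2 * R + 6 := by
    have h1 : ‖(1 - 2 * τ) • ContinuousLinearMap.id ℝ (EuclideanSpace ℝ (Fin n))‖ ≤ 1 := by
      rw [norm_smul, Real.norm_of_nonneg (by linarith)]
      exact mul_le_one₀ (by linarith) (norm_nonneg _) ContinuousLinearMap.norm_id_le
    have := norm_sub_le A₂ ((1 - 2 * τ) • ContinuousLinearMap.id ℝ (EuclideanSpace ℝ (Fin n)))
    linarith
  have hdist : ∀ w ∈ C, ‖w - x‖ ≤ 2 * R + 6 := fun w hw => by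
    have := norm_sub_le w x
    have := hR w hw
    linarith
  have := hop (ε⁻¹ • (P₁ x - x)) ((-ε⁻¹) • (P₂ x - x)) (ε⁻¹ • B₁) ((-ε⁻¹) • B₂)
    (by rw [norm_smul, Real.norm_of_nonneg hε1.le]; gcongr; exact hdist _ hy)
    (by rw [norm_smul, norm_neg, Real.norm_of_nonneg hε1.le]; gcongr; exact hdist _ hξ)
    (by rw [norm_smul, norm_neg, Real.norm_of_nonneg hε1.le]; gcongr)
    (by
      have h1 : ε⁻¹ • (P₁ x - x) - (-ε⁻¹) • (P₂ x - x) = ε⁻¹ • q := by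
        rw [← hq]; module
      rw [h1, norm_smul, Real.norm_of_nonneg hε1.le, inv_mul_le_iff₀ hε0]
      exact hqδ.le.trans hδ2)
    (fun d => by
      have h1 := inner_add_inner_le_of_isMax hs₁ hs₂ hmax hA₁ hA₂ hτ0 d
      have h2 := mul_le_mul_of_nonneg_right hτ2 (sq_nonneg ‖d‖)
      simp only [smul_apply, real_inner_smul_left]
      have h3 : ⟪B₁ d, d⟫ + ⟪B₂ d, d⟫ ≤ ε * (δ₀ * ‖d‖ ^ 2) := by
        simp only [hB₁, hB₂, sub_apply, smul_apply,
          ContinuousLinearMap.id_apply, inner_sub_left, real_inner_smul_left,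
          real_inner_self_eq_norm_sq]
        linarith
      have h4 := mul_le_mul_of_nonneg_left h3 hε1.le
      rw [hcancel] at h4
      linarith)
  linarith

end Comparison

/-- Remark 6.3(a) (Quotient comparison): if `Δ_p u + λ|u|^{p−2}u ≥ 0`,
`Δ_p v + λ̄ v^{p−1} ≤ 0` with `0 < λ < λ̄`, `v > 0` bounded, then either `u ≤ 0` in `Ω` or
`u/v ≤ sup_{∂Ω} u/v` in `Ω`. -/
theorem stmt19 (n : ℕ) (hn : 2 ≤ n) (p : ℝ) (hp : 2 ≤ p)
    (Ω : Set (EuclideanSpace ℝ (Fin n))) (hΩo : IsOpen Ω) (hΩc : IsConnected Ω)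
    (hΩb : Bornology.IsBounded Ω)
    (lam lam' : ℝ) (hlam : 0 < lam) (hlam' : lam < lam')
    (u v : EuclideanSpace ℝ (Fin n) → ℝ)
    (husc : UpperSemicontinuousOn u (closure Ω))
    (hsub : PLapFSub n p (fun _ s => lam * |s| ^ (p - 2) * s) Ω u)
    (hlsc : LowerSemicontinuousOn v (closure Ω))
    (hvb : ∃ C : ℝ, ∀ x ∈ closure Ω, |v x| ≤ C)
    (hvpos : ∀ x ∈ closure Ω, 0 < v x)
    (hsuper : PLapFSuper n p (fun _ s => lam' * s ^ (p - 1)) Ω v) :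
    (∀ x ∈ Ω, u x ≤ 0) ∨
      ∀ x ∈ Ω, u x / v x ≤ sSup ((fun y => u y / v y) '' frontier Ω) := by
  by_contra! hcon
  obtain ⟨⟨a, haΩ, ha⟩, b, hbΩ, hb⟩ := hcon
  set C := closure Ω with hCdef
  have hC : IsCompact C := hΩb.isCompact_closure
  have hΩC : Ω ⊆ C := subset_closure
  obtain ⟨w, hwC, hw⟩ := hlsc.exists_isMinOn ⟨a, hΩC haΩ⟩ hC
  have hw0 := hvpos w hwC
  obtain ⟨Vm, hVm⟩ := hvb
  obtain ⟨s, hsC, hs⟩ := husc.exists_isMaxOn ⟨a, hΩC haΩ⟩ hC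
  have hbdd : BddAbove ((fun y => u y / v y) '' C) := by
    refine ⟨|u s| / v w, ?_⟩
    rintro _ ⟨y, hy, rfl⟩
    have h1 : u y ≤ |u s| := (hs hy).trans (le_abs_self _)
    have h2 : v w ≤ v y := hw hy
    exact (div_le_div_of_nonneg_right h1 (hvpos y hy).le).trans
      (div_le_div_of_nonneg_left (abs_nonneg _) hw0 h2)
  set M := sSup ((fun y => u y / v y) '' C) with hM
  have hleM : ∀ y ∈ C, u y ≤ M * v y := fun y hy => by
    rw [← div_le_iff₀ (hvpos y hy)]
    exact le_csSup hbdd (mem_image_of_mem _ hy)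
  have hM0 : 0 < M :=
    (div_pos ha (hvpos a (hΩC haΩ))).trans_le (le_csSup hbdd (mem_image_of_mem _ (hΩC haΩ)))
  have hfront : ∀ y ∈ C, u y = M * v y → y ∈ Ω := by
    intro y hy hyM
    by_contra hyΩ
    have hyf : y ∈ frontier Ω := by
      rw [hΩo.frontier_eq]
      exact ⟨hy, hyΩ⟩
    have h1 : u y / v y ≤ sSup ((fun y => u y / v y) '' frontier Ω) :=
      le_csSup (hbdd.mono (image_mono frontier_subset_closure)) (mem_image_of_mem _ hyf)
    rw [hyM, mul_div_cancel_right₀ _ (hvpos y hy).ne'] at h1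
    have h2 : u b / v b ≤ M := le_csSup hbdd (mem_image_of_mem _ (hΩC hbΩ))
    linarith
  have hVlsc : LowerSemicontinuousOn (fun y => M * v y) C :=
    (continuous_const.mul continuous_id : Continuous fun t : ℝ => M * t).comp_lowerSemicontinuousOn
      hlsc fun a b hab => mul_le_mul_of_nonneg_left hab hM0.le
  have hnegV : UpperSemicontinuousOn (fun y => -M * v y) C :=
    (continuous_const.mul continuous_id :
      Continuous fun t : ℝ => -M * t).comp_lowerSemicontinuousOn_antitone hlsc
      fun a b hab => mul_le_mul_of_nonpos_left hab (by linarith)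
  obtain ⟨z, hzC, hz⟩ := (husc.add hnegV).exists_isMaxOn ⟨a, hΩC haΩ⟩ hC
  have hcontact : u z = M * v z := by
    refine le_antisymm (hleM z hzC) (not_lt.1 fun hlt => ?_)
    have hVm0 : 0 < Vm := (hvpos a (hΩC haΩ)).trans_le ((le_abs_self _).trans (hVm a (hΩC haΩ)))
    have hgap : 0 < (M * v z - u z) / Vm := div_pos (by linarith) hVm0
    have : M ≤ M - (M * v z - u z) / Vm := by
      refine csSup_le ⟨_, mem_image_of_mem _ (hΩC haΩ)⟩ ?_
      rintro _ ⟨y, hy, rfl⟩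
      have h1 : u y + -M * v y ≤ u z + -M * v z := hz hy
      have h2 : (M * v z - u z) / Vm * v y ≤ (M * v z - u z) / Vm * Vm :=
        mul_le_mul_of_nonneg_left ((le_abs_self _).trans (hVm y hy)) hgap.le
      rw [div_mul_cancel₀ _ hVm0.ne'] at h2
      change u y / v y ≤ _
      rw [div_le_iff₀ (hvpos y hy), sub_mul]
      linarith
    linarith
  refine no_interior_contact hC hΩo husc hVlsc hleM hfront hp hlam hlam' (mul_pos hM0 hw0)
    (fun y hy => mul_le_mul_of_nonneg_left (hw hy) hM0.le) (fun y hy η A h => ?_)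
    (fun y hy η A h => ?_) hzC hcontact
  · have := hsub _ (contDiff_quadPoly (u y) y η A) y hy (by
      filter_upwards [nhdsWithin_le_nhds h, self_mem_nhdsWithin] with x hx hxΩ
      have h1 := hx (hΩC hxΩ)
      have h2 : quadPoly (u y) y η A y = u y := by simp [quadPoly]
      rw [h2]
      linarith)
    rwa [pLap_quadPoly hp] at this
  · have := hsuper _ (contDiff_quadPoly (v y) y (M⁻¹ • η) (M⁻¹ • A)) y hy (by
      filter_upwards [nhdsWithin_le_nhds h, self_mem_nhdsWithin] with x hx hxΩ
      have h1 := mul_le_mul_of_nonneg_left (hx (hΩC hxΩ)) (inv_pos.2 hM0).le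
      rw [← quadPoly_smul, inv_mul_cancel_left₀ hM0.ne', inv_mul_cancel_left₀ hM0.ne'] at h1
      have h2 : quadPoly (v y) y (M⁻¹ • η) (M⁻¹ • A) y = v y := by simp [quadPoly]
      rw [h2]
      linarith)
    rw [pLap_quadPoly hp, pLapOp_smul (inv_pos.2 hM0)] at this
    have h1 := mul_le_mul_of_nonneg_left this (Real.rpow_nonneg hM0.le (p - 1))
    rw [mul_add, ← mul_assoc, ← Real.mul_rpow hM0.le (inv_pos.2 hM0).le,
      mul_inv_cancel₀ hM0.ne', Real.one_rpow, one_mul, mul_zero] at h1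
    rw [Real.mul_rpow hM0.le (hvpos y (hΩC hy)).le]
    linarith
end
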